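/- Let R^{(1)} ⊆ U be the linear span of the elements r^{(1)}_{i,{x,y}}, over all i ∈ N and all 2-element subsets {x,y} ⊆ N∖{i}. Then the images of the basis vectors δ_{{A,A'}} span the quotient U/R^{(1)} (so the ψ_i classes are superfluous in the quotient), and dim_ℚ(U/R^{(1)}) = 2^{n−1} − n(n−1)/2 − 1. -/

import Mathlib

/-- Index type for the unordered partitions `N = A ⊔ A'` with `|A|, |A'| ≥ 2`, encoded as
the two-element set `{A, Aᶜ}` of subsets of `N`. -/
def PartIdx (N : Type*) [Fintype N] [DecidableEq N] :=
  {P : Finset (Finset N) // ∃ A : Finset N, 2 ≤ A.card ∧ 2 ≤ Aᶜ.card ∧ P = {A, Aᶜ}}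

/-- Index type for the basis of `U`: the `ψ_i` for `i ∈ N`, and the `δ_{{A,A'}}` for the
unordered partitions `N = A ⊔ A'` with `|A|, |A'| ≥ 2`. -/
def Uidx (N : Type*) [Fintype N] [DecidableEq N] := N ⊕ PartIdx N

/-- The ℚ-vector space `U` with basis vectors `ψ_i` and `δ_{{A,A'}}`. -/
noncomputable abbrev GKU (N : Type*) [Fintype N] [DecidableEq N] := Uidx N →₀ ℚ

/-- The basis vector `ψ_i` of `U`. -/
noncomputable def psiU {N : Type*} [Fintype N] [DecidableEq N] (i : N) : GKU N :=
  Finsupp.single (Sum.inl i) 1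

/-- The basis vector `δ_{{A, Aᶜ}}` of `U`, extended by `0` when the cardinality
constraints fail. -/
noncomputable def deltaU {N : Type*} [Fintype N] [DecidableEq N] (A : Finset N) : GKU N :=
  if h : 2 ≤ A.card ∧ 2 ≤ Aᶜ.card then
    Finsupp.single (Sum.inr ⟨{A, Aᶜ}, A, h.1, h.2, rfl⟩) 1
  else 0

/-- The relation vector `r^{(1)}_{i,{x,y}} = ψ_i − Σ δ_{{A,A'}}`, the sum over all
partitions `A ⊔ A' = N` with `|A|, |A'| ≥ 2`, `i ∈ A` and `x, y ∈ A'`. -/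
noncomputable def rel1U {N : Type*} [Fintype N] [DecidableEq N] (i x y : N) : GKU N :=
  psiU i - ∑ A ∈ Finset.univ.filter
      (fun A : Finset N => i ∈ A ∧ x ∈ Aᶜ ∧ y ∈ Aᶜ ∧ 2 ≤ A.card ∧ 2 ≤ Aᶜ.card),
    deltaU A

/-- The relation vector `r^{(2)}_{i,j} = ψ_i + ψ_j − Σ δ_{{A,A'}}`, the sum over all
partitions `A ⊔ A' = N` with `|A|, |A'| ≥ 2`, `i ∈ A` and `j ∈ A'`. -/
noncomputable def rel2U {N : Type*} [Fintype N] [DecidableEq N] (i j : N) : GKU N :=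
  psiU i + psiU j - ∑ A ∈ Finset.univ.filter
      (fun A : Finset N => i ∈ A ∧ j ∈ Aᶜ ∧ 2 ≤ A.card ∧ 2 ≤ Aᶜ.card),
    deltaU A


/-- The subspace `R^{(1)} ⊆ U` spanned by the relations `r^{(1)}_{i,{x,y}}`, over all
`i ∈ N` and 2-element subsets `{x,y} ⊆ N ∖ {i}`. -/
noncomputable def rel1SpanU (N : Type*) [Fintype N] [DecidableEq N] : Submodule ℚ (GKU N) :=
  Submodule.span ℚ {v : GKU N | ∃ i x y : N, i ≠ x ∧ i ≠ y ∧ x ≠ y ∧ v = rel1U i x y}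

/-- The index of the basis vector `ψ_i`. -/
def psiIdx {N : Type*} [Fintype N] [DecidableEq N] (i : N) : Uidx N :=
  Sum.inl i

/-- The index of the basis vector `δ_{{A, Aᶜ}}`. -/
def deltaIdx {N : Type*} [Fintype N] [DecidableEq N] (A : Finset N)
    (h : 2 ≤ A.card ∧ 2 ≤ Aᶜ.card) : Uidx N :=
  Sum.inr ⟨{A, Aᶜ}, A, h.1, h.2, rfl⟩

theorem psiU_eq_single {N : Type*} [Fintype N] [DecidableEq N] (i : N) :
    psiU i = Finsupp.single (psiIdx i) 1 :=
  rfl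

theorem deltaU_eq_single {N : Type*} [Fintype N] [DecidableEq N] (A : Finset N)
    (h : 2 ≤ A.card ∧ 2 ≤ Aᶜ.card) : deltaU A = Finsupp.single (deltaIdx A h) 1 :=
  dif_pos h

theorem psiIdx_inj {N : Type*} [Fintype N] [DecidableEq N] {i j : N} :
    psiIdx i = psiIdx j ↔ i = j :=
  Sum.inl.inj_iff

theorem psiIdx_ne_deltaIdx {N : Type*} [Fintype N] [DecidableEq N] (i : N) (A : Finset N)
    (h : 2 ≤ A.card ∧ 2 ≤ Aᶜ.card) : psiIdx i ≠ deltaIdx A h :=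
  Sum.inl_ne_inr

theorem deltaIdx_inj {N : Type*} [Fintype N] [DecidableEq N] {A B : Finset N}
    (hA : 2 ≤ A.card ∧ 2 ≤ Aᶜ.card) (hB : 2 ≤ B.card ∧ 2 ≤ Bᶜ.card) :
    deltaIdx A hA = deltaIdx B hB ↔ A = B ∨ A = Bᶜ := by
  constructor
  · intro hP
    have hP' : ({A, Aᶜ} : Finset (Finset N)) = {B, Bᶜ} :=
      congrArg Subtype.val (Sum.inr.inj hP)
    have hmem : A ∈ ({B, Bᶜ} : Finset (Finset N)) := hP' ▸ Finset.mem_insert_self A {Aᶜ}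
    simpa only [Finset.mem_insert, Finset.mem_singleton] using hmem
  · rintro (rfl | rfl)
    · rfl
    · refine congrArg Sum.inr (Subtype.ext ?_)
      change ({Bᶜ, Bᶜᶜ} : Finset (Finset N)) = {B, Bᶜ}
      rw [compl_compl, Finset.pair_comm]

theorem deltaU_apply_deltaIdx {N : Type*} [Fintype N] [DecidableEq N] (A B : Finset N)
    (h : 2 ≤ A.card ∧ 2 ≤ Aᶜ.card) :
    deltaU B (deltaIdx A h) = (if B = A then 1 else 0) + (if B = Aᶜ then 1 else 0) := by
  classical
  have hne : A ≠ Aᶜ := by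
    obtain ⟨a, ha⟩ := Finset.card_pos.mp (by omega : 0 < A.card)
    intro hA
    exact Finset.mem_compl.mp (hA ▸ ha) ha
  by_cases hB : 2 ≤ B.card ∧ 2 ≤ Bᶜ.card
  · rw [deltaU_eq_single B hB, Finsupp.single_apply]
    simp only [deltaIdx_inj]
    by_cases hBA : B = A
    · subst hBA
      simp [hne]
    · simp [hBA]
  · have hBA : B ≠ A := fun hc => hB (hc ▸ h)
    have hBA' : B ≠ Aᶜ := by
      rintro rfl
      exact hB (by simpa using h.symm)
    rw [deltaU, dif_neg hB, Finsupp.zero_apply, if_neg hBA, if_neg hBA', add_zero]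

theorem deltaU_apply_psiIdx {N : Type*} [Fintype N] [DecidableEq N] (B : Finset N) (k : N) :
    deltaU B (psiIdx k) = 0 := by
  classical
  by_cases hB : 2 ≤ B.card ∧ 2 ≤ Bᶜ.card
  · rw [deltaU_eq_single B hB, Finsupp.single_apply, if_neg (psiIdx_ne_deltaIdx k B hB).symm]
  · rw [deltaU, dif_neg hB, Finsupp.zero_apply]

theorem psiU_apply_psiIdx {N : Type*} [Fintype N] [DecidableEq N] (i k : N) :
    psiU i (psiIdx k) = if i = k then 1 else 0 := by
  classical
  rw [psiU_eq_single, Finsupp.single_apply]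
  simp only [psiIdx_inj]

theorem psiU_apply_deltaIdx {N : Type*} [Fintype N] [DecidableEq N] (i : N) (A : Finset N)
    (h : 2 ≤ A.card ∧ 2 ≤ Aᶜ.card) : psiU i (deltaIdx A h) = 0 := by
  classical
  rw [psiU_eq_single, Finsupp.single_apply, if_neg (psiIdx_ne_deltaIdx i A h)]

theorem GKU_ext {N : Type*} [Fintype N] [DecidableEq N] {u v : GKU N}
    (hpsi : ∀ k, u (psiIdx k) = v (psiIdx k))
    (hdelta : ∀ (A : Finset N) (h : 2 ≤ A.card ∧ 2 ≤ Aᶜ.card),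
      u (deltaIdx A h) = v (deltaIdx A h)) :
    u = v := by
  refine Finsupp.ext ?_
  rintro (k | ⟨_, A, h1, h2, rfl⟩)
  · exact hpsi k
  · exact hdelta A ⟨h1, h2⟩

theorem rel1U_apply_psiIdx {N : Type*} [Fintype N] [DecidableEq N] (i x y k : N) :
    rel1U i x y (psiIdx k) = if i = k then 1 else 0 := by
  simp [rel1U, deltaU_apply_psiIdx, psiU_apply_psiIdx]

theorem rel2U_apply_psiIdx {N : Type*} [Fintype N] [DecidableEq N] (i j k : N) :
    rel2U i j (psiIdx k) = (if i = k then 1 else 0) + (if j = k then 1 else 0) := by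
  simp [rel2U, deltaU_apply_psiIdx, psiU_apply_psiIdx]

theorem rel1U_apply_deltaIdx {N : Type*} [Fintype N] [DecidableEq N] (i x y : N) (A : Finset N)
    (h : 2 ≤ A.card ∧ 2 ≤ Aᶜ.card) :
    rel1U i x y (deltaIdx A h) =
      -((if i ∈ A ∧ x ∉ A ∧ y ∉ A then 1 else 0) +
        (if i ∉ A ∧ x ∈ A ∧ y ∈ A then 1 else 0)) := by
  simp [rel1U, deltaU_apply_deltaIdx _ _ h, psiU_apply_deltaIdx, Finset.sum_add_distrib, h]

theorem rel2U_apply_deltaIdx {N : Type*} [Fintype N] [DecidableEq N] (i j : N) (A : Finset N)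
    (h : 2 ≤ A.card ∧ 2 ≤ Aᶜ.card) :
    rel2U i j (deltaIdx A h) =
      -((if i ∈ A ∧ j ∉ A then 1 else 0) + (if i ∉ A ∧ j ∈ A then 1 else 0)) := by
  simp [rel2U, deltaU_apply_deltaIdx _ _ h, psiU_apply_deltaIdx, Finset.sum_add_distrib, h]

theorem rel2U_comm {N : Type*} [Fintype N] [DecidableEq N] (i j : N) :
    rel2U i j = rel2U j i := by
  refine GKU_ext (fun k => ?_) (fun A h => ?_)
  · rw [rel2U_apply_psiIdx, rel2U_apply_psiIdx, add_comm]
  · rw [rel2U_apply_deltaIdx, rel2U_apply_deltaIdx, add_comm]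
    simp only [and_comm]

theorem rel2U_eq_rel1U_add_rel1U {N : Type*} [Fintype N] [DecidableEq N] (i j k : N) :
    rel2U i j = rel1U i j k + rel1U j i k := by
  refine GKU_ext (fun l => ?_) (fun A h => ?_)
  · rw [Finsupp.add_apply, rel2U_apply_psiIdx, rel1U_apply_psiIdx, rel1U_apply_psiIdx]
  · rw [Finsupp.add_apply, rel2U_apply_deltaIdx, rel1U_apply_deltaIdx, rel1U_apply_deltaIdx]
    by_cases hi : i ∈ A <;> by_cases hj : j ∈ A <;> by_cases hk : k ∈ A <;> simp [hi, hj, hk]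

theorem rel1U_eq_smul_rel2U {N : Type*} [Fintype N] [DecidableEq N] (i x y : N) :
    rel1U i x y = (1 / 2 : ℚ) • (rel2U i x + rel2U i y - rel2U x y) := by
  refine GKU_ext (fun l => ?_) (fun A h => ?_)
  · rw [Finsupp.smul_apply, Finsupp.sub_apply, Finsupp.add_apply, rel1U_apply_psiIdx]
    simp only [rel2U_apply_psiIdx, smul_eq_mul]
    ring
  · rw [Finsupp.smul_apply, Finsupp.sub_apply, Finsupp.add_apply, rel1U_apply_deltaIdx]
    simp only [rel2U_apply_deltaIdx, smul_eq_mul]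
    by_cases hi : i ∈ A <;> by_cases hx : x ∈ A <;> by_cases hy : y ∈ A <;>
      norm_num [hi, hx, hy]

/-- The relation `r^{(2)}` as a function of an unordered pair of distinct points. -/
noncomputable def rel2USym (N : Type*) [Fintype N] [DecidableEq N]
    (e : {e : Sym2 N // ¬e.IsDiag}) : GKU N :=
  Sym2.lift ⟨rel2U, rel2U_comm⟩ e.1

theorem rel1SpanU_eq_span_rel2USym {N : Type*} [Fintype N] [DecidableEq N]
    (hn : 4 ≤ Fintype.card N) :
    rel1SpanU N = Submodule.span ℚ (Set.range (rel2USym N)) := by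
  have hmem {i j : N} (hij : i ≠ j) :
      rel2U i j ∈ Submodule.span ℚ (Set.range (rel2USym N)) :=
    Submodule.subset_span ⟨⟨s(i, j), by simpa using hij⟩, rfl⟩
  apply le_antisymm
  · refine Submodule.span_le.mpr ?_
    rintro _ ⟨i, x, y, hix, hiy, hxy, rfl⟩
    rw [rel1U_eq_smul_rel2U]
    exact Submodule.smul_mem _ _
      (Submodule.sub_mem _ (Submodule.add_mem _ (hmem hix) (hmem hiy)) (hmem hxy))
  · refine Submodule.span_le.mpr ?_
    rintro _ ⟨⟨e, he⟩, rfl⟩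
    induction e using Sym2.ind with
    | _ i j =>
      have hij : i ≠ j := by simpa using he
      obtain ⟨k, hk⟩ : ∃ k, k ∉ ({i, j} : Finset N) := by
        by_contra! hall
        have hle := Finset.card_le_card (fun a _ => hall a : Finset.univ ⊆ {i, j})
        rw [Finset.card_univ, Finset.card_pair hij] at hle
        omega
      simp only [Finset.mem_insert, Finset.mem_singleton, not_or] at hk
      change rel2U i j ∈ rel1SpanU N
      rw [rel2U_eq_rel1U_add_rel1U i j k]
      exact Submodule.add_mem _
        (Submodule.subset_span ⟨i, j, k, hij, Ne.symm hk.1, Ne.symm hk.2, rfl⟩)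
        (Submodule.subset_span ⟨j, i, k, hij.symm, Ne.symm hk.2, Ne.symm hk.1, rfl⟩)

theorem linearIndependent_rel2USym {N : Type*} [Fintype N] [DecidableEq N]
    (hn : 4 ≤ Fintype.card N) : LinearIndependent ℚ (rel2USym N) := by
  have hdual (e : {e : Sym2 N // ¬e.IsDiag}) : ∃ f : Module.Dual ℚ (GKU N),
      ∀ e', f (rel2USym N e') = if e = e' then 1 else 0 := by
    obtain ⟨e, he⟩ := e
    induction e using Sym2.ind with
    | _ i j =>
      have hij : i ≠ j := by simpa using he
      have hA : 2 ≤ ({i, j} : Finset N).card ∧ 2 ≤ ({i, j} : Finset N)ᶜ.card := by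
        rw [Finset.card_compl, Finset.card_pair hij]
        omega
      refine ⟨(1 / 2 : ℚ) • (Finsupp.lapply (psiIdx i) + Finsupp.lapply (psiIdx j) +
        Finsupp.lapply (deltaIdx {i, j} hA)), ?_⟩
      rintro ⟨e', he'⟩
      induction e' using Sym2.ind with
      | _ k l =>
        have hkl : k ≠ l := by simpa using he'
        change (1 / 2 : ℚ) * (rel2U k l (psiIdx i) + rel2U k l (psiIdx j) +
          rel2U k l (deltaIdx {i, j} hA)) = _
        rw [rel2U_apply_psiIdx, rel2U_apply_psiIdx, rel2U_apply_deltaIdx k l _ hA]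
        simp only [Subtype.mk.injEq, Sym2.eq_iff, Finset.mem_insert, Finset.mem_singleton]
        by_cases hki : k = i <;> by_cases hkj : k = j <;> by_cases hli : l = i <;>
          by_cases hlj : l = j <;> grind
  choose f hf using hdual
  exact LinearIndependent.of_pairwise_dual_eq_zero_one _ f
    (fun e e' hne => by simp [hf, hne]) (fun e => by simp [hf])

theorem finrank_rel1SpanU {N : Type*} [Fintype N] [DecidableEq N] (hn : 4 ≤ Fintype.card N) :
    Module.finrank ℚ (rel1SpanU N) = Fintype.card N * (Fintype.card N - 1) / 2 := by
  rw [rel1SpanU_eq_span_rel2USym hn, finrank_span_eq_card (linearIndependent_rel2USym hn),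
    Sym2.card_subtype_not_diag, Nat.choose_two_right]

noncomputable instance PartIdx.instFintype (N : Type*) [Fintype N] [DecidableEq N] :
    Fintype (PartIdx N) :=
  inferInstanceAs (Fintype {_P : Finset (Finset N) // _})

noncomputable instance Uidx.instFintype (N : Type*) [Fintype N] [DecidableEq N] :
    Fintype (Uidx N) :=
  inferInstanceAs (Fintype (N ⊕ PartIdx N))

/-- Each unordered partition is determined by its part avoiding a fixed point `p`. -/
theorem card_partIdx_eq_card_filter {N : Type*} [Fintype N] [DecidableEq N] (p : N) :
    Fintype.card (PartIdx N) =
      (Finset.univ.filter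
        (fun A : Finset N => p ∉ A ∧ 2 ≤ A.card ∧ 2 ≤ Aᶜ.card)).card := by
  symm
  rw [← Finset.card_univ]
  refine Finset.card_bij
    (fun A hA => ⟨{A, Aᶜ}, A, (Finset.mem_filter.mp hA).2.2.1,
      (Finset.mem_filter.mp hA).2.2.2, rfl⟩) (fun _ _ => Finset.mem_univ _) ?_ ?_
  · intro A hA B hB hAB
    have hP : ({A, Aᶜ} : Finset (Finset N)) = {B, Bᶜ} := congrArg Subtype.val hAB
    have hmem : A ∈ ({B, Bᶜ} : Finset (Finset N)) := hP ▸ Finset.mem_insert_self A {Aᶜ}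
    simp only [Finset.mem_insert, Finset.mem_singleton] at hmem
    simp only [Finset.mem_filter] at hA hB
    refine hmem.resolve_right fun hc => hA.2.1 ?_
    rw [hc]
    exact Finset.mem_compl.mpr hB.2.1
  · rintro ⟨P, A, h1, h2, rfl⟩ -
    by_cases hp : p ∈ A
    · refine ⟨Aᶜ, by simp [hp, h1, h2], Subtype.ext ?_⟩
      change ({Aᶜ, Aᶜᶜ} : Finset (Finset N)) = {A, Aᶜ}
      rw [compl_compl, Finset.pair_comm]
    · exact ⟨A, by simp [hp, h1, h2], rfl⟩

theorem card_partIdx {N : Type*} [Fintype N] [DecidableEq N] (hn : 4 ≤ Fintype.card N) :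
    Fintype.card (PartIdx N) + (Fintype.card N + 1) = 2 ^ (Fintype.card N - 1) := by
  obtain ⟨p⟩ : Nonempty N := Fintype.card_pos_iff.mp (by omega)
  have htotal : (Finset.univ.filter (fun A : Finset N => p ∉ A)).card =
      2 ^ (Fintype.card N - 1) := by
    rw [show Finset.univ.filter (fun A : Finset N => p ∉ A) =
      (Finset.univ.erase p).powerset by
        ext A
        simp [Finset.subset_erase], Finset.card_powerset,
      Finset.card_erase_of_mem (Finset.mem_univ p), Finset.card_univ]
  have hsmall : (Finset.univ.filter
      (fun A : Finset N => p ∉ A ∧ ¬(2 ≤ A.card ∧ 2 ≤ Aᶜ.card))) =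
      insert ∅ (insert {p}ᶜ ((Finset.univ.erase p).image singleton)) := by
    ext A
    simp only [Finset.mem_filter, Finset.mem_univ, true_and, Finset.mem_insert,
      Finset.mem_image, Finset.mem_erase, and_true]
    constructor
    · rintro ⟨hp, hA⟩
      rcases Nat.lt_or_ge A.card 2 with h | h
      · rcases Nat.lt_or_ge A.card 1 with h0 | h1
        · exact Or.inl (Finset.card_eq_zero.mp (by omega))
        · obtain ⟨a, rfl⟩ := Finset.card_eq_one.mp (by omega : A.card = 1)
          exact Or.inr (Or.inr ⟨a, fun hap => hp (by simp [hap]), rfl⟩)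
      · have hAc : Aᶜ.card ≤ 1 := by
          by_contra hc
          exact hA ⟨h, by omega⟩
        have hAp : Aᶜ = {p} := Finset.eq_singleton_iff_unique_mem.mpr
          ⟨Finset.mem_compl.mpr hp, fun x hx =>
            Finset.card_le_one.mp hAc x hx p (Finset.mem_compl.mpr hp)⟩
        exact Or.inr (Or.inl (by rw [← hAp, compl_compl]))
    · rintro (rfl | rfl | ⟨a, ha, rfl⟩)
      · simp
      · simp
      · simp [Ne.symm ha]
  have hcard : (insert ∅ (insert {p}ᶜ ((Finset.univ.erase p).image singleton)) :
      Finset (Finset N)).card = Fintype.card N + 1 := by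
    have hc : ({p}ᶜ : Finset N).card = Fintype.card N - 1 := by simp [Finset.card_compl]
    rw [Finset.card_insert_of_notMem, Finset.card_insert_of_notMem,
      Finset.card_image_of_injective _ Finset.singleton_injective,
      Finset.card_erase_of_mem (Finset.mem_univ p), Finset.card_univ]
    · omega
    · simp only [Finset.mem_image, not_exists, not_and]
      intro a _ ha
      rw [← ha, Finset.card_singleton] at hc
      omega
    · simp only [Finset.mem_insert, Finset.mem_image, not_or, not_exists, not_and]
      refine ⟨fun h => ?_, fun a _ => Finset.singleton_ne_empty a⟩
      rw [← h, Finset.card_empty] at hc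
      omega
  have hsplit := Finset.card_filter_add_card_filter_not
    (s := Finset.univ.filter (fun A : Finset N => p ∉ A))
    (fun A : Finset N => 2 ≤ A.card ∧ 2 ≤ Aᶜ.card)
  rw [Finset.filter_filter, Finset.filter_filter] at hsplit
  rwa [card_partIdx_eq_card_filter p, ← hcard, ← hsmall, ← htotal]

theorem finrank_GKU {N : Type*} [Fintype N] [DecidableEq N] (hn : 4 ≤ Fintype.card N) :
    Module.finrank ℚ (GKU N) + 1 = 2 ^ (Fintype.card N - 1) := by
  have hU : Fintype.card (Uidx N) = Fintype.card N + Fintype.card (PartIdx N) :=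
    Fintype.card_sum
  rw [Module.finrank_finsupp_self, hU, ← card_partIdx hn]
  ring

theorem span_mk_delta_eq_top {N : Type*} [Fintype N] [DecidableEq N]
    (hn : 4 ≤ Fintype.card N) :
    Submodule.span ℚ (Set.range (fun P : PartIdx N =>
      Submodule.Quotient.mk (p := rel1SpanU N) (Finsupp.single (Sum.inr P) 1))) = ⊤ := by
  set S := Submodule.span ℚ (Set.range (fun P : PartIdx N =>
      Submodule.Quotient.mk (p := rel1SpanU N) (Finsupp.single (Sum.inr P) 1))) with hS
  have hdelta (A : Finset N) : (rel1SpanU N).mkQ (deltaU A) ∈ S := by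
    unfold deltaU
    split_ifs
    · exact Submodule.subset_span ⟨_, rfl⟩
    · rw [map_zero]
      exact S.zero_mem
  have hpsi (i : N) : (rel1SpanU N).mkQ (psiU i) ∈ S := by
    obtain ⟨x, hx, y, hy, hxy⟩ := Finset.one_lt_card.mp
      (by rw [Finset.card_erase_of_mem (Finset.mem_univ i), Finset.card_univ]; omega :
        1 < (Finset.univ.erase i).card)
    have hrel : (rel1SpanU N).mkQ (rel1U i x y) = 0 :=
      (Submodule.Quotient.mk_eq_zero _).mpr (Submodule.subset_span
        ⟨i, x, y, (Finset.ne_of_mem_erase hx).symm, (Finset.ne_of_mem_erase hy).symm, hxy, rfl⟩)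
    rw [rel1U, map_sub, sub_eq_zero] at hrel
    rw [hrel, map_sum]
    exact S.sum_mem fun A _ => hdelta A
  have hbasis (a : Uidx N) : (rel1SpanU N).mkQ (Finsupp.single a 1) ∈ S := by
    rcases a with i | P
    · exact hpsi i
    · exact Submodule.subset_span ⟨P, rfl⟩
  refine Submodule.eq_top_iff'.mpr fun q => ?_
  obtain ⟨u, rfl⟩ := Submodule.mkQ_surjective _ q
  induction u using Finsupp.induction_linear with
  | zero => exact S.zero_mem
  | add u v hu hv => exact (map_add (rel1SpanU N).mkQ u v).symm ▸ S.add_mem hu hv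
  | single a c =>
    rw [← mul_one c, ← smul_eq_mul, ← Finsupp.smul_single, map_smul]
    exact S.smul_mem c (hbasis a)

/-- The images of the basis vectors `δ_{{A,A'}}` span the quotient `U/R^{(1)}` (so the
`ψ_i` classes are superfluous in the quotient), and
`dim_ℚ (U/R^{(1)}) = 2^{n-1} - n(n-1)/2 - 1`. -/
theorem delta_span_quotient_and_finrank {N : Type*} [Fintype N] [DecidableEq N]
    (hn : 4 ≤ Fintype.card N) :
    Submodule.span ℚ (Set.range (fun P : PartIdx N =>
      Submodule.Quotient.mk (p := rel1SpanU N) (Finsupp.single (Sum.inr P) 1))) = ⊤ ∧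
    Module.finrank ℚ (GKU N ⧸ rel1SpanU N) =
      2 ^ (Fintype.card N - 1) - Fintype.card N * (Fintype.card N - 1) / 2 - 1 := by
  refine ⟨span_mk_delta_eq_top hn, ?_⟩
  have hquot := Submodule.finrank_quotient_add_finrank (rel1SpanU N)
  rw [finrank_rel1SpanU hn] at hquot
  have hU := finrank_GKU hn
  omega
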